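/- Let θ be a nonzero irrational real number, let a_k denote the partial quotients and q_k the denominators of the convergents of the continued fraction expansion of θ. Then liminf_{n→∞} n·ln(n)·min{‖n·θ‖, ‖n·θ^{−1}‖} < ∞ if and only if limsup_{k→∞} q_{k+1}/(q_k·ln(q_k)) > 0. -/

import Mathlib

open Filter

/-- Distance from a real number to the nearest integer. -/
noncomputable def nint (x : ℝ) : ℝ := |x - (round x : ℝ)|

/-- The Gauss map orbit of `θ`: `cfX θ 0 = θ` and `cfX θ (k+1) = 1 / (fractional part of cfX θ k)`. -/
noncomputable def cfX (θ : ℝ) : ℕ → ℝ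
  | 0 => θ
  | k + 1 => (Int.fract (cfX θ k))⁻¹

/-- The partial quotients of the continued fraction expansion of `θ`. -/
noncomputable def cfA (θ : ℝ) (k : ℕ) : ℤ := ⌊cfX θ k⌋

/-- The denominators of the convergents of the continued fraction expansion of `θ`. -/
noncomputable def cfQ (θ : ℝ) : ℕ → ℤ
  | 0 => 1
  | 1 => cfA θ 1
  | (k + 2) => cfA θ (k + 2) * cfQ θ (k + 1) + cfQ θ k

theorem nint_le_abs_sub (x : ℝ) (z : ℤ) : nint x ≤ |x - z| := round_le x z

theorem nint_nonneg (x : ℝ) : 0 ≤ nint x := abs_nonneg _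

theorem Irrational.cfX {θ : ℝ} (h : Irrational θ) (k : ℕ) : Irrational (cfX θ k) := by
  induction k with
  | zero => exact h
  | succ k ih =>
    have : Irrational (Int.fract (_root_.cfX θ k)) := by
      unfold Int.fract
      exact ih.sub_intCast _
    exact this.inv

theorem one_lt_cfX_succ {θ : ℝ} (h : Irrational θ) (k : ℕ) : 1 < cfX θ (k + 1) := by
  have hpos : 0 < Int.fract (cfX θ k) := by
    refine lt_of_le_of_ne (Int.fract_nonneg _) fun h0 => ?_
    have := h.cfX k
    have h1 := Int.self_sub_floor (cfX θ k)
    exact this.ne_int ⌊cfX θ k⌋ (by linarith)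
  exact (one_lt_inv₀ hpos).2 (Int.fract_lt_one _)

theorem one_le_cfA_succ {θ : ℝ} (h : Irrational θ) (k : ℕ) : 1 ≤ cfA θ (k + 1) :=
  Int.le_floor.2 (by exact_mod_cast (one_lt_cfX_succ h k).le)

theorem one_le_cfQ {θ : ℝ} (h : Irrational θ) (k : ℕ) : 1 ≤ cfQ θ k := by
  induction k using Nat.twoStepInduction with
  | zero => exact le_rfl
  | one => exact one_le_cfA_succ h 0
  | more k h0 h1 =>
    have := one_le_cfA_succ h (k + 1)
    rw [cfQ]
    nlinarith

theorem cfQ_add_le {θ : ℝ} (h : Irrational θ) (k : ℕ) :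
    cfQ θ (k + 1) + cfQ θ k ≤ cfQ θ (k + 2) := by
  have := one_le_cfA_succ h (k + 1)
  have := one_le_cfQ h (k + 1)
  rw [cfQ]
  nlinarith

theorem cfQ_monotone {θ : ℝ} (h : Irrational θ) : Monotone (cfQ θ) := by
  refine monotone_nat_of_le_succ fun k => ?_
  cases k with
  | zero => exact one_le_cfA_succ h 0
  | succ k => linarith [cfQ_add_le h k, one_le_cfQ h k]

theorem le_cfQ {θ : ℝ} (h : Irrational θ) (k : ℕ) : (k : ℤ) ≤ cfQ θ k := by
  induction k using Nat.twoStepInduction with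
  | zero => exact zero_le_one
  | one => exact one_le_cfQ h 1
  | more k h0 h1 =>
    have := cfQ_add_le h k
    have := one_le_cfQ h k
    push_cast at *
    linarith

/-- The numerators of the convergents of the continued fraction expansion of `θ`. -/
noncomputable def cfP (θ : ℝ) : ℕ → ℤ
  | 0 => cfA θ 0
  | 1 => cfA θ 1 * cfA θ 0 + 1
  | (k + 2) => cfA θ (k + 2) * cfP θ (k + 1) + cfP θ k

theorem cfQ_mul_cfP_sub (θ : ℝ) (k : ℕ) :
    cfQ θ k * cfP θ (k + 1) - cfQ θ (k + 1) * cfP θ k = (-1) ^ k := by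
  induction k with
  | zero => simp only [cfQ, cfP]; ring
  | succ k ih =>
    rw [cfP, cfQ, pow_succ, ← ih]
    ring

/-- The signed error `(-1) ^ k * (q_k * θ - p_k)` of the `k`-th convergent. -/
noncomputable def cfErr (θ : ℝ) (k : ℕ) : ℝ := (-1) ^ k * (cfQ θ k * θ - cfP θ k)

theorem cfX_eq (θ : ℝ) (k : ℕ) :
    cfX θ k = cfA θ k + (cfX θ (k + 1))⁻¹ := by
  simp [cfX, cfA]

theorem cfErr_eq_mul {θ : ℝ} (h : Irrational θ) (k : ℕ) :
    cfErr θ k = cfX θ (k + 2) * cfErr θ (k + 1) := by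
  induction k with
  | zero =>
    have h0 := cfX_eq θ 0
    have h1 := cfX_eq θ 1
    have p1 := one_lt_cfX_succ h 0
    have p2 := one_lt_cfX_succ h 1
    have e : cfX θ 0 = θ := rfl
    simp only [cfErr, cfQ, cfP, zero_add] at *
    push_cast
    rw [e] at h0
    have a0 : (cfA θ 0 : ℝ) = θ - (cfX θ 1)⁻¹ := by linarith
    have a1 : (cfA θ 1 : ℝ) = cfX θ 1 - (cfX θ 2)⁻¹ := by linarith
    norm_num at p2
    rw [a0, a1]
    field_simp
    ring
  | succ k ih =>
    have h1 := cfX_eq θ (k + 2)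
    have p2 := one_lt_cfX_succ h (k + 2)
    have hr : cfErr θ (k + 2) = cfErr θ k - cfA θ (k + 2) * cfErr θ (k + 1) := by
      simp only [cfErr, cfQ, cfP]
      push_cast
      ring
    have a1 : (cfA θ (k + 2) : ℝ) = cfX θ (k + 2) - (cfX θ (k + 3))⁻¹ := by linarith
    change _ = cfX θ (k + 3) * cfErr θ (k + 2)
    rw [hr, ih, a1]
    have : cfX θ (k + 3) ≠ 0 := by
      have : 1 < cfX θ (k + 3) := p2
      positivity
    field_simp
    ring

theorem cfErr_pos {θ : ℝ} (h : Irrational θ) (k : ℕ) : 0 < cfErr θ k := by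
  induction k with
  | zero =>
    have h0 := cfX_eq θ 0
    have p1 := one_lt_cfX_succ h 0
    have e : cfX θ 0 = θ := rfl
    have : cfErr θ 0 = (cfX θ 1)⁻¹ := by
      rw [e] at h0
      simp only [cfErr, cfQ, cfP, zero_add] at *
      push_cast
      linarith
    rw [this]
    exact inv_pos.2 (by linarith)
  | succ k ih =>
    rw [cfErr_eq_mul h k] at ih
    exact pos_of_mul_pos_right ih (by linarith [one_lt_cfX_succ h (k + 1)])

theorem cfErr_succ_le {θ : ℝ} (h : Irrational θ) (k : ℕ) : cfErr θ (k + 1) ≤ cfErr θ k := by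
  rw [cfErr_eq_mul h k]
  nlinarith [one_lt_cfX_succ h (k + 1), cfErr_pos h (k + 1)]

theorem cfErr_mul_cfQ_add (θ : ℝ) (k : ℕ) :
    cfErr θ k * cfQ θ (k + 1) + cfErr θ (k + 1) * cfQ θ k = 1 := by
  have h : (cfQ θ k * cfP θ (k + 1) - cfQ θ (k + 1) * cfP θ k : ℝ) = (-1) ^ k := by
    exact_mod_cast cfQ_mul_cfP_sub θ k
  have hs : ((-1 : ℝ) ^ k) * (-1) ^ k = 1 := by
    rw [← mul_pow]; norm_num
  simp only [cfErr, pow_succ]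
  linear_combination (-1) ^ k * h + hs

theorem cfErr_mul_cfQ_succ_le {θ : ℝ} (h : Irrational θ) (k : ℕ) :
    cfErr θ k * cfQ θ (k + 1) ≤ 1 := by
  have hq : (1 : ℝ) ≤ cfQ θ k := by exact_mod_cast one_le_cfQ h k
  nlinarith [cfErr_mul_cfQ_add θ k, cfErr_pos h (k + 1)]

theorem one_le_two_mul_cfErr {θ : ℝ} (h : Irrational θ) (k : ℕ) :
    1 ≤ 2 * (cfErr θ k * cfQ θ (k + 1)) := by
  have hq : (1 : ℝ) ≤ cfQ θ k := by exact_mod_cast one_le_cfQ h k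
  have hm : (cfQ θ k : ℝ) ≤ cfQ θ (k + 1) := by exact_mod_cast cfQ_monotone h k.le_succ
  nlinarith [cfErr_mul_cfQ_add θ k, cfErr_pos h (k + 1), cfErr_succ_le h k,
    mul_le_mul (cfErr_succ_le h k) hm (by linarith) (cfErr_pos h k).le]

theorem abs_cfQ_mul_sub {θ : ℝ} (h : Irrational θ) (k : ℕ) :
    |cfQ θ k * θ - cfP θ k| = cfErr θ k := by
  rw [← abs_of_pos (cfErr_pos h k), cfErr, abs_mul, abs_pow, abs_neg, abs_one, one_pow, one_mul]

theorem le_abs_int_mul_add {u v : ℝ} (hu : 0 < u) (hv : 0 < v) {x y : ℤ}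
    (hxy : 0 < x ∧ y ≤ 0 ∨ x < 0 ∧ 0 ≤ y) : u ≤ |x * u - y * v| := by
  rcases hxy with ⟨hx, hy⟩ | ⟨hx, hy⟩
  · have hx' : (1 : ℝ) ≤ x := by exact_mod_cast hx
    have hy' : (y : ℝ) ≤ 0 := by exact_mod_cast hy
    refine le_trans ?_ (le_abs_self _)
    nlinarith
  · have hx' : (x : ℝ) ≤ -1 := by
      have : x ≤ -1 := by omega
      exact_mod_cast this
    have hy' : (0 : ℝ) ≤ y := by exact_mod_cast hy
    refine le_trans ?_ (neg_le_abs _)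
    nlinarith

/-- Convergents are best approximations of the second kind. -/
theorem cfErr_le_abs_sub {θ : ℝ} (h : Irrational θ) (k : ℕ) {n : ℤ} (hn : 0 < n)
    (hnq : n < cfQ θ (k + 1)) (m : ℤ) : cfErr θ k ≤ |n * θ - m| := by
  have hdet := cfQ_mul_cfP_sub θ k
  have hs : ((-1 : ℤ) ^ k) * (-1) ^ k = 1 := by
    rw [← mul_pow]; norm_num
  obtain ⟨x, y, hx, hy⟩ : ∃ x y : ℤ, n = x * cfQ θ k + y * cfQ θ (k + 1) ∧
      m = x * cfP θ k + y * cfP θ (k + 1) := by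
    refine ⟨(-1) ^ k * (n * cfP θ (k + 1) - m * cfQ θ (k + 1)),
      (-1) ^ k * (m * cfQ θ k - n * cfP θ k), ?_, ?_⟩
    · linear_combination (-n) * hs - (-1) ^ k * n * hdet
    · linear_combination (-m) * hs - (-1) ^ k * m * hdet
  have hq := one_le_cfQ h k
  have hq' := one_le_cfQ h (k + 1)
  have hsign : 0 < x ∧ y ≤ 0 ∨ x < 0 ∧ 0 ≤ y := by
    rcases lt_trichotomy x 0 with hx0 | hx0 | hx0
    · right
      refine ⟨hx0, ?_⟩
      by_contra! hy0
      nlinarith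
    · exfalso
      subst hx0
      have : 0 < y := by
        by_contra! hy0
        nlinarith
      nlinarith
    · left
      refine ⟨hx0, ?_⟩
      by_contra! hy0
      nlinarith
  refine (le_abs_int_mul_add (cfErr_pos h k) (cfErr_pos h (k + 1)) hsign).trans_eq ?_
  have : (x * cfErr θ k - y * cfErr θ (k + 1) : ℝ) = (-1) ^ k * (n * θ - m) := by
    rw [hx, hy]
    simp only [cfErr, pow_succ]
    push_cast
    ring
  rw [this, abs_mul, abs_pow, abs_neg, abs_one, one_pow, one_mul]

theorem exists_cfQ_le_lt {θ : ℝ} (h : Irrational θ) {K n : ℕ} (hn : cfQ θ K ≤ n) :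
    ∃ k, K ≤ k ∧ cfQ θ k ≤ n ∧ (n : ℤ) < cfQ θ (k + 1) := by
  classical
  have hex : ∃ j, (n : ℤ) < cfQ θ j :=
    ⟨n + 1, by have := le_cfQ h (n + 1); push_cast at this; omega⟩
  have hK : K < Nat.find hex := by
    by_contra! hle
    have := cfQ_monotone h hle
    have := Nat.find_spec hex
    omega
  obtain ⟨k, hk⟩ := Nat.exists_eq_succ_of_ne_zero (Nat.ne_zero_of_lt hK)
  have hlt := Nat.find_spec hex
  rw [hk] at hlt
  refine ⟨k, by omega, ?_, hlt⟩
  exact not_lt.1 (Nat.find_min hex (by omega))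

theorem two_le_cfQ {θ : ℝ} (h : Irrational θ) {k : ℕ} (hk : 2 ≤ k) : (2 : ℝ) ≤ cfQ θ k := by
  have : (2 : ℤ) ≤ cfQ θ k := le_trans (by exact_mod_cast hk) (le_cfQ h k)
  exact_mod_cast this

theorem exists_frequently_cfQ_ratio {θ : ℝ} (h : Irrational θ) {C : ℝ}
    (hC : ∀ N : ℕ, ∃ n ≥ N, (n : ℝ) * Real.log n * nint (n * θ) ≤ C) :
    ∃ c : ℝ, 0 < c ∧ ∃ᶠ k : ℕ in atTop,
      c ≤ (cfQ θ (k + 1) : ℝ) / ((cfQ θ k : ℝ) * Real.log (cfQ θ k : ℝ)) := by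
  refine ⟨(2 * max C 1)⁻¹, by positivity, frequently_atTop.2 fun K => ?_⟩
  obtain ⟨n, hn, hnC⟩ := hC (cfQ θ (K + 2)).toNat
  obtain ⟨k, hk, hkn, hnk⟩ := exists_cfQ_le_lt h (K := K + 2) (n := n) (Int.toNat_le.1 hn)
  refine ⟨k, by omega, ?_⟩
  have hq := two_le_cfQ h (k := k) (by omega)
  have hq' := two_le_cfQ h (k := k + 1) (by omega)
  have hqn : (cfQ θ k : ℝ) ≤ n := by exact_mod_cast hkn
  have hlog : 0 < Real.log (cfQ θ k) := Real.log_pos (by linarith)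
  have hlog' : Real.log (cfQ θ k) ≤ Real.log n := Real.log_le_log (by linarith) hqn
  have hnpos : 0 < (n : ℤ) := by linarith [one_le_cfQ h k]
  have hbest : cfErr θ k ≤ nint (n * θ) := by
    have := cfErr_le_abs_sub h k hnpos hnk (round ((n : ℝ) * θ))
    exact_mod_cast this
  have hmul : cfQ θ k * Real.log (cfQ θ k) ≤ n * Real.log n := by gcongr
  have h1 : 1 ≤ 2 * (nint (n * θ) * cfQ θ (k + 1)) := by
    refine (one_le_two_mul_cfErr h k).trans ?_
    gcongr
  have h2 : (n : ℝ) * Real.log n ≤ 2 * max C 1 * cfQ θ (k + 1) := by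
    have hle : (n : ℝ) * Real.log n * nint (n * θ) ≤ max C 1 := hnC.trans (le_max_left _ _)
    have hnl : 0 ≤ (n : ℝ) * Real.log n := le_trans (by positivity) hmul
    nlinarith [mul_le_mul_of_nonneg_left h1 hnl,
      mul_le_mul_of_nonneg_right hle (by linarith : (0 : ℝ) ≤ cfQ θ (k + 1))]
  rw [le_div_iff₀ (by positivity), inv_mul_le_iff₀ (by positivity)]
  linarith

theorem exists_bound_mul_of_inv {θ C : ℝ} (hθ : θ ≠ 0)
    (hC : ∀ N : ℕ, ∃ n ≥ N, (n : ℝ) * Real.log n * nint (n * θ⁻¹) ≤ C) :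
    ∃ C' : ℝ, ∀ N : ℕ, ∃ n ≥ N, (n : ℝ) * Real.log n * nint (n * θ) ≤ C' := by
  have hθ' : 0 < |θ| := abs_pos.2 hθ
  set A : ℝ := |θ|⁻¹ + 1 with hA
  have hA1 : 1 < A := lt_add_of_pos_left 1 (inv_pos.2 hθ')
  refine ⟨2 * A * |θ| * max C 0, fun N => ?_⟩
  obtain ⟨n, hn, hnC⟩ := hC (max (⌈A⌉₊) ⌈(N + 2) * |θ|⌉₊)
  have hnA : A ≤ n := (Nat.le_ceil A).trans (by exact_mod_cast (le_max_left _ _).trans hn)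
  have hnN : (N + 2) * |θ| ≤ n :=
    (Nat.le_ceil _).trans (by exact_mod_cast (le_max_right _ _).trans hn)
  set r : ℤ := round ((n : ℝ) * θ⁻¹) with hr
  have he : nint ((n : ℝ) * θ⁻¹) = |(n : ℝ) * θ⁻¹ - r| := rfl
  have he2 : |(n : ℝ) * θ⁻¹ - r| ≤ 1 / 2 := abs_sub_round _
  have hcast : ((r.natAbs : ℕ) : ℝ) = |(r : ℝ)| := by simp [Nat.cast_natAbs]
  have habs : |(n : ℝ) * θ⁻¹| = n * |θ|⁻¹ := by
    rw [abs_mul, abs_inv, Nat.abs_cast]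
  have hlow : (n : ℝ) * |θ|⁻¹ - 1 ≤ |(r : ℝ)| := by
    have := abs_sub_abs_le_abs_sub ((n : ℝ) * θ⁻¹) r
    linarith
  have hup : |(r : ℝ)| ≤ n * |θ|⁻¹ + 1 := by
    have := abs_sub_abs_le_abs_sub (r : ℝ) ((n : ℝ) * θ⁻¹)
    rw [abs_sub_comm] at this
    linarith
  have hN : (N : ℝ) + 2 ≤ n * |θ|⁻¹ := by
    rw [← div_eq_mul_inv, le_div_iff₀ hθ']
    exact hnN
  have hrN : (N : ℝ) + 1 ≤ |(r : ℝ)| := by linarith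
  have hN0 : (0 : ℝ) ≤ N := N.cast_nonneg
  have hrA : |(r : ℝ)| ≤ A * n := by
    rw [hA]
    linarith
  have hlogr : Real.log |(r : ℝ)| ≤ 2 * Real.log n := by
    calc Real.log |(r : ℝ)| ≤ Real.log (A * n) := Real.log_le_log (by linarith) hrA
      _ = Real.log A + Real.log n := Real.log_mul (by linarith) (by linarith)
      _ ≤ Real.log n + Real.log n := by
        gcongr
      _ = 2 * Real.log n := by ring
  have hlogn : 0 ≤ Real.log n := Real.log_nonneg (by linarith)
  have hlogr0 : 0 ≤ Real.log |(r : ℝ)| := Real.log_nonneg (by linarith)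
  have hrθ : |(r : ℝ) * θ - n| = |θ| * nint ((n : ℝ) * θ⁻¹) := by
    rw [he, ← abs_mul, abs_sub_comm]
    congr 1
    field_simp
  have hnint : nint (|(r : ℝ)| * θ) ≤ |θ| * nint ((n : ℝ) * θ⁻¹) := by
    rw [← hrθ]
    rcases abs_choice (r : ℝ) with hc | hc
    · rw [hc]
      exact_mod_cast nint_le_abs_sub ((r : ℝ) * θ) n
    · rw [hc]
      refine (nint_le_abs_sub _ (-n)).trans_eq ?_
      rw [← abs_neg]
      congr 1
      push_cast
      ring
  refine ⟨r.natAbs, ?_, ?_⟩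
  · have : (N : ℝ) ≤ (r.natAbs : ℕ) := by rw [hcast]; linarith
    exact_mod_cast this
  · rw [hcast]
    have hnn := nint_nonneg ((n : ℝ) * θ⁻¹)
    calc |(r : ℝ)| * Real.log |(r : ℝ)| * nint (|(r : ℝ)| * θ)
        ≤ (A * n) * (2 * Real.log n) * (|θ| * nint ((n : ℝ) * θ⁻¹)) :=
          mul_le_mul (mul_le_mul hrA hlogr hlogr0 (by positivity)) hnint (nint_nonneg _)
            (by positivity)
      _ = 2 * A * |θ| * (n * Real.log n * nint ((n : ℝ) * θ⁻¹)) := by ring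
      _ ≤ 2 * A * |θ| * max C 0 := by
        gcongr
        exact hnC.trans (le_max_left _ _)

theorem stmt_13 (θ : ℝ) (hθ : θ ≠ 0) (hirr : Irrational θ) :
    (∃ C : ℝ, ∃ᶠ n : ℕ in atTop,
        (n : ℝ) * Real.log n * min (nint ((n : ℝ) * θ)) (nint ((n : ℝ) * θ⁻¹)) ≤ C)
    ↔ (∃ c : ℝ, 0 < c ∧ ∃ᶠ k : ℕ in atTop,
        c ≤ (cfQ θ (k + 1) : ℝ) / ((cfQ θ k : ℝ) * Real.log (cfQ θ k : ℝ))) := by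
  constructor
  · rintro ⟨C, hC⟩
    have hsplit : ∃ᶠ n : ℕ in atTop, (n : ℝ) * Real.log n * nint (n * θ) ≤ C ∨
        (n : ℝ) * Real.log n * nint (n * θ⁻¹) ≤ C := by
      refine hC.mono fun n hn => ?_
      rcases min_choice (nint ((n : ℝ) * θ)) (nint ((n : ℝ) * θ⁻¹)) with hm | hm
      · exact Or.inl (hm ▸ hn)
      · exact Or.inr (hm ▸ hn)
    rcases frequently_or_distrib.1 hsplit with h | h
    · exact exists_frequently_cfQ_ratio hirr (frequently_atTop.1 h)
    · obtain ⟨C', hC'⟩ := exists_bound_mul_of_inv hθ (frequently_atTop.1 h)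
      exact exists_frequently_cfQ_ratio hirr hC'
  · rintro ⟨c, hc, hfreq⟩
    refine ⟨c⁻¹, frequently_atTop.2 fun N => ?_⟩
    obtain ⟨k, hk, hck⟩ := frequently_atTop.1 hfreq (N + 2)
    have hq := two_le_cfQ hirr (k := k) (by omega)
    have hq' := two_le_cfQ hirr (k := k + 1) (by omega)
    have hlog : 0 < Real.log (cfQ θ k) := Real.log_pos (by linarith)
    have hkq := le_cfQ hirr k
    have hcast : (((cfQ θ k).toNat : ℕ) : ℝ) = cfQ θ k := by
      exact_mod_cast Int.toNat_of_nonneg (by linarith [one_le_cfQ hirr k])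
    refine ⟨(cfQ θ k).toNat, by omega, ?_⟩
    rw [hcast]
    rw [le_div_iff₀ (by positivity)] at hck
    have hmin : min (nint (cfQ θ k * θ)) (nint (cfQ θ k * θ⁻¹)) ≤ cfErr θ k :=
      (min_le_left _ _).trans ((nint_le_abs_sub _ (cfP θ k)).trans_eq (abs_cfQ_mul_sub hirr k))
    have herr := cfErr_mul_cfQ_succ_le hirr k
    have hpos := cfErr_pos hirr k
    calc _ ≤ cfQ θ k * Real.log (cfQ θ k) * cfErr θ k := by gcongr
      _ ≤ c⁻¹ := by
        rw [← mul_one c⁻¹, le_inv_mul_iff₀ hc]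
        nlinarith [mul_le_mul_of_nonneg_right hck hpos.le]
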